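/- arXiv:2512.02342 — 10 statements merged into one kernel-verified Lean document; each statement's English description precedes it below -/
import Mathlib

section
/- Consider the stochastic subgradient method with the safeguarded stochastic Polyak step size SPS_safe. Then E[f(x̄^T) − f(x*)] ≤ (√(max{G², M})·‖x^0 − x*‖)/√T + √(max{G², M}/M)·σ². -/
open RealInnerProductSpace

/-- Averaging over all index tuples, a quantity `φ i ω` that does not depend on the `t`-th
coordinate of `ω` may be evaluated at `i = ω t`, or averaged over `i` independently. -/
theorem card_mul_sum_apply_coord {ι α : Type*} [Fintype ι] [DecidableEq ι] [Fintype α]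
    (t : ι) (φ : α → (ι → α) → ℝ)
    (hφ : ∀ i ω j, φ i (Function.update ω t j) = φ i ω) :
    (Fintype.card α : ℝ) * ∑ ω : ι → α, φ (ω t) ω = ∑ ω : ι → α, ∑ i, φ i ω := by
  have key : ∑ p : (ι → α) × α, φ (p.1 t) p.1 = ∑ p : (ι → α) × α, φ p.2 p.1 := by
    refine Finset.sum_bij' (fun p _ => (Function.update p.1 t p.2, p.1 t))
      (fun p _ => (Function.update p.1 t p.2, p.1 t)) ?_ ?_ ?_ ?_ ?_
    · simp
    · simp
    · simp
    · simp
    · intro p _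
      exact (hφ _ _ _).symm
  rw [Fintype.sum_prod_type, Fintype.sum_prod_type] at key
  rw [← key, Finset.mul_sum]
  simp

/-- One step of the subgradient method with the safeguarded Polyak step size. -/
theorem sq_sub_le_of_polyak_step {E : Type*} [NormedAddCommGroup E] [InnerProductSpace ℝ E]
    {x y g : E} {fx fy l M L : ℝ} (hM : 0 < M) (hconv : fx + ⟪g, y - x⟫ ≤ fy)
    (hx : l ≤ fx) (hL : max (‖g‖ ^ 2) M ≤ L) :
    (fx - fy) ^ 2 ≤
      L * (‖x - y‖ ^ 2 - ‖x - ((fx - l) / max (‖g‖ ^ 2) M) • g - y‖ ^ 2)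
        + L / M * (fy - l) ^ 2 := by
  set D := max (‖g‖ ^ 2) M with hD
  have hMD : M ≤ D := le_max_right _ _
  have hgD : ‖g‖ ^ 2 ≤ D := le_max_left _ _
  have hD0 : 0 < D := hM.trans_le hMD
  have hL0 : 0 < L := hD0.trans_le hL
  set γ := (fx - l) / D with hγ
  have hγ0 : 0 ≤ γ := div_nonneg (sub_nonneg.2 hx) hD0.le
  have hγD : γ * D = fx - l := div_mul_cancel₀ _ hD0.ne'
  have hexp : ‖x - γ • g - y‖ ^ 2 = ‖x - y‖ ^ 2 + 2 * (γ * ⟪g, y - x⟫) + γ ^ 2 * ‖g‖ ^ 2 := by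
    rw [show x - γ • g - y = (x - y) - γ • g by abel, norm_sub_sq_real, norm_smul, mul_pow,
      Real.norm_eq_abs, sq_abs, inner_smul_right, real_inner_comm, ← neg_sub y x, inner_neg_right]
    ring
  have h1 : γ * ⟪g, y - x⟫ ≤ γ * (fy - fx) :=
    mul_le_mul_of_nonneg_left (by linarith) hγ0
  have h2 : γ ^ 2 * ‖g‖ ^ 2 ≤ γ ^ 2 * D := mul_le_mul_of_nonneg_left hgD (sq_nonneg _)
  have h3 : (fx - fy) ^ 2 / D ≤
      ‖x - y‖ ^ 2 - ‖x - γ • g - y‖ ^ 2 + (fy - l) ^ 2 / D := by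
    have h4 : (fx - fy) ^ 2 / D - (fy - l) ^ 2 / D = -2 * (γ * (fy - fx)) - γ ^ 2 * D := by
      rw [hγ]
      field_simp
      ring
    linarith
  have h5 : (fx - fy) ^ 2 / L ≤ (fx - fy) ^ 2 / D := by gcongr
  have h6 : (fy - l) ^ 2 / D ≤ (fy - l) ^ 2 / M := by gcongr
  have h7 : (fx - fy) ^ 2 / L ≤
      ‖x - y‖ ^ 2 - ‖x - γ • g - y‖ ^ 2 + (fy - l) ^ 2 / M := by linarith
  calc (fx - fy) ^ 2 = L * ((fx - fy) ^ 2 / L) := by field_simp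
    _ ≤ L * (‖x - y‖ ^ 2 - ‖x - γ • g - y‖ ^ 2 + (fy - l) ^ 2 / M) :=
      mul_le_mul_of_nonneg_left h7 hL0.le
    _ = _ := by ring

/-- Jensen's inequality for a function with a subgradient at the average point. -/
theorem apply_average_le_of_subgradient {E : Type*} [NormedAddCommGroup E]
    [InnerProductSpace ℝ E] {f : E → ℝ} {T : ℕ} (hT : 1 ≤ T) (z : ℕ → E) (g : E)
    (hg : ∀ y, f ((T : ℝ)⁻¹ • ∑ t ∈ Finset.range T, z t)
      + ⟪g, y - (T : ℝ)⁻¹ • ∑ t ∈ Finset.range T, z t⟫ ≤ f y) :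
    T * f ((T : ℝ)⁻¹ • ∑ t ∈ Finset.range T, z t) ≤ ∑ t ∈ Finset.range T, f (z t) := by
  have hT0 : (T : ℝ) ≠ 0 := by positivity
  set w := (T : ℝ)⁻¹ • ∑ t ∈ Finset.range T, z t with hw
  have hsum : ∑ t ∈ Finset.range T, (z t - w) = 0 := by
    rw [Finset.sum_sub_distrib, Finset.sum_const, Finset.card_range, ← Nat.cast_smul_eq_nsmul ℝ,
      hw, smul_inv_smul₀ hT0, sub_self]
  have h := Finset.sum_le_sum fun t (_ : t ∈ Finset.range T) => hg (z t)
  rw [Finset.sum_add_distrib, ← inner_sum, hsum, inner_zero_right] at h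
  simpa using h

/-- Iterates driven by the indices `ω` do not depend on the current or later indices. -/
theorem iterate_update_eq {α E : Type*} {T : ℕ} (step : α → E → E) (x : (Fin T → α) → ℕ → E)
    {x0 : E} (hx0 : ∀ ω, x ω 0 = x0)
    (hstep : ∀ ω, ∀ t : ℕ, ∀ ht : t < T, x ω (t + 1) = step (ω ⟨t, ht⟩) (x ω t))
    (t : Fin T) (j : α) (ω : Fin T → α) (s : ℕ) (hs : s ≤ t) :
    x (Function.update ω t j) s = x ω s := by
  induction s with
  | zero => rw [hx0, hx0]
  | succ s ih =>
    have hsT : s < T := by omega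
    have hne : (⟨s, hsT⟩ : Fin T) ≠ t := fun h => by
      have := congrArg Fin.val h
      simp only at this
      omega
    rw [hstep _ s hsT, hstep _ s hsT, ih (by omega), Function.update_of_ne hne]

/-- Convergence of the stochastic subgradient method with the safeguarded
stochastic Polyak step size `SPS_safe` (Theorem 3.1):
`E[f(x̄^T) − f(x*)] ≤ √(max{G², M})·‖x⁰ − x*‖/√T + √(max{G², M}/M)·σ²`,
where the expectation is over tuples `ω = (i_0,…,i_{T−1})` of indices drawn
independently and uniformly from `{1,…,n}`, the iterates follow
`x^{t+1} = x^t − γ_t·g_{i_t}(x^t)` with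
`γ_t = (f_{i_t}(x^t) − ℓ_{i_t}) / max{‖g_{i_t}(x^t)‖², M}`, and
`x̄^T = (1/T)·Σ_{t<T} x^t`, `σ² = ((1/n)·Σ_i (f_i(x*) − ℓ_i)²)^{1/2}`. -/
theorem ssm_sps_safe_convergence (d n T : ℕ) (hd : 1 ≤ d) (hn : 1 ≤ n)
    (hT : 1 ≤ T)
    (f : Fin n → EuclideanSpace ℝ (Fin d) → ℝ)
    (g : Fin n → EuclideanSpace ℝ (Fin d) → EuclideanSpace ℝ (Fin d))
    (G M : ℝ) (ℓ : Fin n → ℝ)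
    (hconv : ∀ i x y, f i x + ⟪g i x, y - x⟫ ≤ f i y)
    (hG : ∀ i x, ‖g i x‖ ≤ G)
    (hl : ∀ i x, ℓ i ≤ f i x)
    (F : EuclideanSpace ℝ (Fin d) → ℝ)
    (hF : ∀ x, F x = (n : ℝ)⁻¹ * ∑ i, f i x)
    (xstar : EuclideanSpace ℝ (Fin d))
    (hmin : ∀ x, F xstar ≤ F x)
    (σ2 : ℝ) (hσ2 : σ2 = Real.sqrt ((n : ℝ)⁻¹ * ∑ i, (f i xstar - ℓ i) ^ 2))
    (hM : 0 < M)
    (x0 : EuclideanSpace ℝ (Fin d))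
    (x : (Fin T → Fin n) → ℕ → EuclideanSpace ℝ (Fin d))
    (hx0 : ∀ ω, x ω 0 = x0)
    (hstep : ∀ ω, ∀ t : ℕ, ∀ ht : t < T,
      x ω (t + 1) = x ω t -
        ((f (ω ⟨t, ht⟩) (x ω t) - ℓ (ω ⟨t, ht⟩)) /
            max (‖g (ω ⟨t, ht⟩) (x ω t)‖ ^ 2) M) • g (ω ⟨t, ht⟩) (x ω t)) :
    ((n : ℝ) ^ T)⁻¹ * ∑ ω : Fin T → Fin n,
        (F ((T : ℝ)⁻¹ • ∑ t ∈ Finset.range T, x ω t) - F xstar) ≤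
      Real.sqrt (max (G ^ 2) M) * ‖x0 - xstar‖ / Real.sqrt T +
        Real.sqrt (max (G ^ 2) M / M) * σ2 := by
  set L := max (G ^ 2) M with hL
  have hL0 : 0 < L := hM.trans_le (le_max_right _ _)
  have hn0 : (0 : ℝ) < n := by positivity
  have hT0 : (0 : ℝ) < T := by positivity
  have hN0 : (0 : ℝ) < (n : ℝ) ^ T := by positivity
  have hgL : ∀ i y, max (‖g i y‖ ^ 2) M ≤ L := fun i y =>
    max_le_max_right _ (pow_le_pow_left₀ (norm_nonneg _) (hG i y) 2)
  have hσ0 : 0 ≤ σ2 := hσ2 ▸ Real.sqrt_nonneg _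
  have hσsq : ∑ i, (f i xstar - ℓ i) ^ 2 = n * σ2 ^ 2 := by
    rw [hσ2, Real.sq_sqrt (by positivity)]
    field_simp
  have hadapt := iterate_update_eq
    (fun i y => y - ((f i y - ℓ i) / max (‖g i y‖ ^ 2) M) • g i y) x hx0 hstep
  set δ : (Fin T → Fin n) → Fin T → ℝ := fun ω t => f (ω t) (x ω t) - f (ω t) xstar with hδ
  have hjensen : ∀ ω, T * (F ((T : ℝ)⁻¹ • ∑ t ∈ Finset.range T, x ω t) - F xstar) ≤
      ∑ t : Fin T, (F (x ω t) - F xstar) := by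
    intro ω
    have h := apply_average_le_of_subgradient (f := F) hT (x ω)
      ((n : ℝ)⁻¹ • ∑ i, g i ((T : ℝ)⁻¹ • ∑ t ∈ Finset.range T, x ω t)) (fun y => by
        rw [hF, hF, inner_smul_left, sum_inner, RCLike.conj_to_real, ← mul_add,
          ← Finset.sum_add_distrib]
        gcongr
        exact hconv _ _ _)
    rw [← Fin.sum_univ_eq_sum_range (fun t => F (x ω t))] at h
    rw [Finset.sum_sub_distrib]
    simp only [Finset.sum_const, Finset.card_univ, Fintype.card_fin, nsmul_eq_mul]
    linarith
  have hcond : ∑ ω, ∑ t : Fin T, (F (x ω t) - F xstar) = ∑ ω, ∑ t, δ ω t := by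
    rw [Finset.sum_comm, Finset.sum_comm (f := δ)]
    refine Finset.sum_congr rfl fun t _ => ?_
    have h := card_mul_sum_apply_coord t (fun i ω => f i (x ω t) - f i xstar)
      (fun i ω j => by rw [hadapt t j ω t le_rfl])
    rw [Fintype.card_fin] at h
    rw [← mul_right_inj' hn0.ne', h, Finset.mul_sum]
    refine Finset.sum_congr rfl fun ω _ => ?_
    rw [hF, hF, Finset.sum_sub_distrib]
    field_simp
  have hnoise : ∑ ω : Fin T → Fin n, ∑ t, (f (ω t) xstar - ℓ (ω t)) ^ 2 =
      (n : ℝ) ^ T * T * σ2 ^ 2 := by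
    rw [Finset.sum_comm]
    have h : ∀ t : Fin T, ∑ ω : Fin T → Fin n, (f (ω t) xstar - ℓ (ω t)) ^ 2 =
        (n : ℝ) ^ T * σ2 ^ 2 := fun t => by
      have h := card_mul_sum_apply_coord t
        (fun i (_ : Fin T → Fin n) => (f i xstar - ℓ i) ^ 2) (fun _ _ _ => rfl)
      rw [← mul_right_inj' hn0.ne']
      simp only [hσsq, Finset.sum_const, Finset.card_univ, Fintype.card_pi_const, Fintype.card_fin,
        nsmul_eq_mul, Nat.cast_pow] at h
      rw [h]
      ring
    simp only [h, Finset.sum_const, Finset.card_univ, Fintype.card_fin, nsmul_eq_mul]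
    ring
  have hpath : ∀ ω, ∑ t, δ ω t ^ 2 ≤
      L * ‖x0 - xstar‖ ^ 2 + L / M * ∑ t, (f (ω t) xstar - ℓ (ω t)) ^ 2 := by
    intro ω
    have h : ∀ t : Fin T, δ ω t ^ 2 ≤
        L * (‖x ω t - xstar‖ ^ 2 - ‖x ω (t + 1) - xstar‖ ^ 2)
          + L / M * (f (ω t) xstar - ℓ (ω t)) ^ 2 := fun t => by
      rw [hstep ω t t.2]
      exact sq_sub_le_of_polyak_step hM (hconv _ _ _) (hl _ _) (hgL _ _)
    refine (Finset.sum_le_sum fun t _ => h t).trans ?_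
    rw [Finset.sum_add_distrib, ← Finset.mul_sum, ← Finset.mul_sum,
      Fin.sum_univ_eq_sum_range (fun t => ‖x ω t - xstar‖ ^ 2 - ‖x ω (t + 1) - xstar‖ ^ 2),
      Finset.sum_range_sub', hx0]
    gcongr
    exact sub_le_self _ (sq_nonneg _)
  have hsq : ∑ ω, ∑ t, δ ω t ^ 2 ≤
      (n : ℝ) ^ T * (L * ‖x0 - xstar‖ ^ 2 + L / M * (T * σ2 ^ 2)) := by
    refine (Finset.sum_le_sum fun ω _ => hpath ω).trans_eq ?_
    rw [Finset.sum_add_distrib, ← Finset.mul_sum, ← Finset.mul_sum, hnoise]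
    simp only [Finset.sum_const, Finset.card_univ, Fintype.card_pi_const, Fintype.card_fin,
      nsmul_eq_mul, Nat.cast_pow]
    ring
  have hCS : (∑ ω, ∑ t, δ ω t) ^ 2 ≤ (n : ℝ) ^ T * T * ∑ ω, ∑ t, δ ω t ^ 2 := by
    have h := sq_sum_le_card_mul_sum_sq (s := Finset.univ)
      (f := fun p : (Fin T → Fin n) × Fin T => δ p.1 p.2)
    simpa [Fintype.sum_prod_type] using h
  set S := ∑ ω, ∑ t, δ ω t
  have hLHS : ((n : ℝ) ^ T)⁻¹ * ∑ ω : Fin T → Fin n,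
      (F ((T : ℝ)⁻¹ • ∑ t ∈ Finset.range T, x ω t) - F xstar) ≤ S / ((n : ℝ) ^ T * T) := by
    have h := Finset.sum_le_sum fun ω (_ : ω ∈ Finset.univ) => hjensen ω
    rw [hcond, ← Finset.mul_sum] at h
    rw [le_div_iff₀ (by positivity)]
    refine le_of_eq_of_le ?_ h
    field_simp
  refine hLHS.trans (le_of_abs_le (abs_le_of_sq_le_sq ?_ (by positivity)))
  have hmean : (S / ((n : ℝ) ^ T * T)) ^ 2 ≤ L * ‖x0 - xstar‖ ^ 2 / T + L / M * σ2 ^ 2 := by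
    rw [div_pow, div_le_iff₀ (by positivity)]
    refine (hCS.trans (mul_le_mul_of_nonneg_left hsq (by positivity))).trans_eq ?_
    field_simp
  refine hmean.trans ?_
  have hA : (√L * ‖x0 - xstar‖ / √T) ^ 2 = L * ‖x0 - xstar‖ ^ 2 / T := by
    rw [div_pow, mul_pow, Real.sq_sqrt hL0.le, Real.sq_sqrt hT0.le]
  have hB : (√(L / M) * σ2) ^ 2 = L / M * σ2 ^ 2 := by
    rw [mul_pow, Real.sq_sqrt (by positivity)]
  have hAB : 0 ≤ (√L * ‖x0 - xstar‖ / √T) * (√(L / M) * σ2) := by positivity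
  rw [← hA, ← hB, add_sq]
  linarith
end

section
/- Assume in addition the interpolation condition with ℓ_i chosen as the optimal values: f_i(x*) = ℓ_i for every i ∈ {1,…,n} (so that σ² = 0). Then the stochastic subgradient method with the safeguarded stochastic Polyak step size SPS_safe satisfies E[f(x̄^T) − f(x*)] ≤ (√(max{G², M})·‖x^0 − x*‖)/√T. -/
open RealInnerProductSpace

/-- Averaging over `ω` a quantity evaluated at the coordinate `ω t` is the same as averaging it
over all values of that coordinate, provided it does not otherwise depend on `ω t`. -/
theorem card_mul_sum_apply_eq_sum_sum {ι κ : Type*} [Fintype ι] [DecidableEq ι] [Fintype κ]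
    (t : ι) (h : (ι → κ) → κ → ℝ)
    (hh : ∀ ω j i, h (Function.update ω t j) i = h ω i) :
    (Fintype.card κ : ℝ) * ∑ ω, h ω (ω t) = ∑ ω, ∑ i, h ω i := by
  have hinv : Function.Involutive
      (fun p : (ι → κ) × κ => (Function.update p.1 t p.2, p.1 t)) := by
    rintro ⟨ω, i⟩
    simp
  have key : ∑ p : (ι → κ) × κ, h p.1 (p.1 t) = ∑ p : (ι → κ) × κ, h p.1 p.2 := by
    refine Fintype.sum_equiv hinv.toPerm _ _ ?_
    rintro ⟨ω, i⟩
    simp [hh]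
  rw [Fintype.sum_prod_type, Fintype.sum_prod_type] at key
  rw [← key]
  simp [Finset.mul_sum]

/-- One step of the safeguarded Polyak method decreases the squared distance to a minimizer `z`,
where `r` bounds from below the linearized gap `⟪g, x - z⟫`. -/
theorem norm_sub_smul_sub_sq_le {E : Type*} [NormedAddCommGroup E] [InnerProductSpace ℝ E]
    (x z g : E) {r M K : ℝ} (hr : 0 ≤ r) (hrg : r ≤ ⟪g, x - z⟫) (hM : 0 < M)
    (hK : max (‖g‖ ^ 2) M ≤ K) :
    ‖x - (r / max (‖g‖ ^ 2) M) • g - z‖ ^ 2 ≤ ‖x - z‖ ^ 2 - r ^ 2 / K := by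
  set L := max (‖g‖ ^ 2) M
  have hL : 0 < L := lt_max_of_lt_right hM
  have hgL : ‖g‖ ^ 2 ≤ L := le_max_left _ _
  have hγ : 0 ≤ r / L := by positivity
  have hexp : ‖x - (r / L) • g - z‖ ^ 2 =
      ‖x - z‖ ^ 2 - 2 * (r / L) * ⟪g, x - z⟫ + (r / L) ^ 2 * ‖g‖ ^ 2 := by
    rw [sub_right_comm, norm_sub_sq_real, inner_smul_right, norm_smul, mul_pow,
      Real.norm_eq_abs, sq_abs, real_inner_comm]
    ring
  have h1 : (r / L) * r ≤ (r / L) * ⟪g, x - z⟫ := mul_le_mul_of_nonneg_left hrg hγ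
  have h2 : (r / L) ^ 2 * ‖g‖ ^ 2 ≤ (r / L) ^ 2 * L := mul_le_mul_of_nonneg_left hgL (sq_nonneg _)
  have h3 : (r / L) ^ 2 * L = r ^ 2 / L := by field_simp
  have h4 : (r / L) * r = r ^ 2 / L := by ring
  have h5 : r ^ 2 / K ≤ r ^ 2 / L := div_le_div_of_nonneg_left (sq_nonneg r) hL hK
  rw [hexp]
  linarith

/-- Jensen's inequality for the average of finitely many points, for a function with a
subgradient selection. -/
theorem card_mul_apply_average_le_sum {E : Type*} [NormedAddCommGroup E] [InnerProductSpace ℝ E]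
    {f : E → ℝ} {g : E → E} (hfg : ∀ x y, f x + ⟪g x, y - x⟫ ≤ f y)
    {T : ℕ} (hT : T ≠ 0) (x : Fin T → E) :
    T * f ((T : ℝ)⁻¹ • ∑ t, x t) ≤ ∑ t, f (x t) := by
  set c := (T : ℝ)⁻¹ • ∑ t, x t with hc
  have hT' : (T : ℝ) ≠ 0 := Nat.cast_ne_zero.mpr hT
  have hzero : ∑ t, ⟪g c, x t - c⟫ = 0 := by
    rw [← inner_sum, Finset.sum_sub_distrib, Finset.sum_const, Finset.card_univ, Fintype.card_fin,
      ← Nat.cast_smul_eq_nsmul ℝ, hc, smul_inv_smul₀ hT', sub_self, inner_zero_right]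
  have := Finset.sum_le_sum fun t (_ : t ∈ Finset.univ) => hfg c (x t)
  rw [Finset.sum_add_distrib, hzero] at this
  simpa using this

/-- A sequence `r` whose squares are dominated by the decrease of a nonnegative potential `a`
has sum at most `√T √(K a₀)`. -/
theorem sum_le_sqrt_mul_of_sq_div_le_sub {T : ℕ} {K : ℝ} (hK : 0 < K) {r : Fin T → ℝ}
    {a : ℕ → ℝ} (ha : 0 ≤ a T) (h : ∀ t : Fin T, a (t + 1) ≤ a t - r t ^ 2 / K) :
    ∑ t, r t ≤ √(T * (K * a 0)) := by
  have htel : ∑ t : Fin T, r t ^ 2 / K ≤ a 0 - a T := by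
    rw [← Finset.sum_range_sub', Finset.sum_range]
    exact Finset.sum_le_sum fun t _ => by linarith [h t]
  rw [← Finset.sum_div, div_le_iff₀ hK] at htel
  have hcs : (∑ t, r t) ^ 2 ≤ T * ∑ t, r t ^ 2 := by
    simpa using sq_sum_le_card_mul_sum_sq (s := Finset.univ) (f := r)
  refine Real.le_sqrt_of_sq_le (hcs.trans ?_)
  gcongr
  nlinarith

/-- Convergence of SSM with `SPS_safe` under interpolation (Corollary 3.2):
if additionally `f_i(x*) = ℓ_i` for every `i` (so that `σ² = 0`), then
`E[f(x̄^T) − f(x*)] ≤ √(max{G², M})·‖x⁰ − x*‖/√T`. -/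
theorem ssm_sps_safe_convergence_interpolation (d n T : ℕ) (hd : 1 ≤ d)
    (hn : 1 ≤ n) (hT : 1 ≤ T)
    (f : Fin n → EuclideanSpace ℝ (Fin d) → ℝ)
    (g : Fin n → EuclideanSpace ℝ (Fin d) → EuclideanSpace ℝ (Fin d))
    (G M : ℝ) (ℓ : Fin n → ℝ)
    (hconv : ∀ i x y, f i x + ⟪g i x, y - x⟫ ≤ f i y)
    (hG : ∀ i x, ‖g i x‖ ≤ G)
    (hl : ∀ i x, ℓ i ≤ f i x)
    (F : EuclideanSpace ℝ (Fin d) → ℝ)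
    (hF : ∀ x, F x = (n : ℝ)⁻¹ * ∑ i, f i x)
    (xstar : EuclideanSpace ℝ (Fin d))
    (hmin : ∀ x, F xstar ≤ F x)
    (hinterp : ∀ i, f i xstar = ℓ i)
    (hM : 0 < M)
    (x0 : EuclideanSpace ℝ (Fin d))
    (x : (Fin T → Fin n) → ℕ → EuclideanSpace ℝ (Fin d))
    (hx0 : ∀ ω, x ω 0 = x0)
    (hstep : ∀ ω, ∀ t : ℕ, ∀ ht : t < T,
      x ω (t + 1) = x ω t -
        ((f (ω ⟨t, ht⟩) (x ω t) - ℓ (ω ⟨t, ht⟩)) /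
            max (‖g (ω ⟨t, ht⟩) (x ω t)‖ ^ 2) M) • g (ω ⟨t, ht⟩) (x ω t)) :
    ((n : ℝ) ^ T)⁻¹ * ∑ ω : Fin T → Fin n,
        (F ((T : ℝ)⁻¹ • ∑ t ∈ Finset.range T, x ω t) - F xstar) ≤
      Real.sqrt (max (G ^ 2) M) * ‖x0 - xstar‖ / Real.sqrt T := by
  have hn' : (0 : ℝ) < n := by exact_mod_cast hn
  have hT' : (0 : ℝ) < T := by exact_mod_cast hT
  set K := max (G ^ 2) M with hK_def
  have hK : 0 < K := lt_max_of_lt_right hM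
  -- the iterate at time `t` depends only on the indices drawn before `t`
  have hadapted : ∀ t ≤ T, ∀ ω ω' : Fin T → Fin n,
      (∀ s : Fin T, (s : ℕ) < t → ω s = ω' s) → x ω t = x ω' t := by
    intro t
    induction t with
    | zero => intros; rw [hx0, hx0]
    | succ t ih =>
      intro ht ω ω' hω
      rw [hstep ω t ht, hstep ω' t ht, hω ⟨t, ht⟩ (Nat.lt_succ_self t),
        ih (Nat.le_of_succ_le ht) ω ω' fun s hs => hω s (hs.trans (Nat.lt_succ_self t))]
  have hgap : ∀ y, F y - F xstar = (n : ℝ)⁻¹ * ∑ i, (f i y - ℓ i) := by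
    intro y
    rw [hF, hF, ← mul_sub, ← Finset.sum_sub_distrib]
    simp only [hinterp]
  have hpath : ∀ ω, ∑ t : Fin T, (f (ω t) (x ω t) - ℓ (ω t)) ≤
      √(T * (K * ‖x0 - xstar‖ ^ 2)) := by
    intro ω
    rw [← hx0 ω]
    refine sum_le_sqrt_mul_of_sq_div_le_sub (a := fun t => ‖x ω t - xstar‖ ^ 2) hK
      (sq_nonneg _) fun t => ?_
    rw [hstep ω t t.isLt]
    refine norm_sub_smul_sub_sq_le _ _ _ (sub_nonneg.mpr (hl _ _)) ?_ hM
      (max_le_max_right M (pow_le_pow_left₀ (norm_nonneg _) (hG _ _) 2))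
    have h := hconv (ω t) (x ω t) xstar
    rw [hinterp, ← neg_sub, inner_neg_right] at h
    linarith
  have hexp : ∀ t : Fin T, ∑ ω, (F (x ω t) - F xstar) =
      ∑ ω : Fin T → Fin n, (f (ω t) (x ω t) - ℓ (ω t)) := by
    intro t
    have h := card_mul_sum_apply_eq_sum_sum (κ := Fin n) t (fun ω i => f i (x ω t) - ℓ i) (by
      intro ω j i
      rw [hadapted t t.isLt.le (Function.update ω t j) ω fun s hs =>
        Function.update_of_ne (fun hst => by simp [hst] at hs) _ _])
    simp only [hgap]
    rw [← Finset.mul_sum, ← h, Fintype.card_fin, inv_mul_cancel_left₀ hn'.ne']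
  have hjensen : ∀ ω, T * (F ((T : ℝ)⁻¹ • ∑ t ∈ Finset.range T, x ω t) - F xstar) ≤
      ∑ t : Fin T, (F (x ω t) - F xstar) := by
    intro ω
    simp only [hgap]
    rw [Finset.sum_range, ← Finset.mul_sum, Finset.sum_comm, mul_left_comm, Finset.mul_sum]
    gcongr with i
    have h := card_mul_apply_average_le_sum (hconv i) (by omega) fun t : Fin T => x ω t
    simp only [Finset.sum_sub_distrib, Finset.sum_const, Finset.card_univ, Fintype.card_fin,
      nsmul_eq_mul]
    linarith
  have htotal : T * ∑ ω : Fin T → Fin n,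
      (F ((T : ℝ)⁻¹ • ∑ t ∈ Finset.range T, x ω t) - F xstar) ≤
      (n : ℝ) ^ T * √(T * (K * ‖x0 - xstar‖ ^ 2)) := by
    calc _ ≤ ∑ ω, ∑ t : Fin T, (F (x ω t) - F xstar) := by
          rw [Finset.mul_sum]
          exact Finset.sum_le_sum fun ω _ => hjensen ω
      _ = ∑ ω : Fin T → Fin n, ∑ t, (f (ω t) (x ω t) - ℓ (ω t)) := by
          rw [Finset.sum_comm, Finset.sum_congr rfl fun t _ => hexp t, Finset.sum_comm]
      _ ≤ ∑ _ω : Fin T → Fin n, √(T * (K * ‖x0 - xstar‖ ^ 2)) :=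
          Finset.sum_le_sum fun ω _ => hpath ω
      _ = _ := by simp
  rw [Real.sqrt_mul hT'.le, Real.sqrt_mul hK.le, Real.sqrt_sq (norm_nonneg _)] at htotal
  have hs : 0 < √(T : ℝ) := Real.sqrt_pos.mpr hT'
  rw [inv_mul_le_iff₀ (by positivity), ← mul_div_assoc, le_div_iff₀ hs]
  refine le_of_mul_le_mul_left ?_ hs
  calc _ = T * ∑ ω : Fin T → Fin n,
      (F ((T : ℝ)⁻¹ • ∑ t ∈ Finset.range T, x ω t) - F xstar) := by
        rw [mul_left_comm, Real.mul_self_sqrt hT'.le, mul_comm]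
    _ ≤ _ := htotal
    _ = _ := by ring
end

section
/- Deterministic subgradient method with safeguarded Polyak step size: the iterates satisfy min_{0 ≤ t ≤ T−1} (f(x^t) − f(x*)) ≤ (√(max{G², M})·‖x^0 − x*‖)/√T. -/
open RealInnerProductSpace

/-- One safeguarded Polyak step decreases the squared distance to `z` by at least `δ² / C`, where
`δ` is a lower bound of the pairing of the subgradient `v` with `y - z`. -/
lemma norm_sq_polyak_step_sub_le {E : Type*} [NormedAddCommGroup E] [InnerProductSpace ℝ E]
    {y z v : E} {δ M C : ℝ} (hM : 0 < M) (hC : max (‖v‖ ^ 2) M ≤ C) (hδ : 0 ≤ δ)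
    (h : δ ≤ ⟪v, y - z⟫) :
    ‖y - (δ / max (‖v‖ ^ 2) M) • v - z‖ ^ 2 ≤ ‖y - z‖ ^ 2 - δ ^ 2 / C := by
  set m := max (‖v‖ ^ 2) M
  have hm : 0 < m := hM.trans_le (le_max_right _ _)
  have hvm : ‖v‖ ^ 2 ≤ m := le_max_left _ _
  have hcross : δ / m * δ ≤ δ / m * ⟪v, y - z⟫ := by gcongr
  have hquad : (δ / m) ^ 2 * ‖v‖ ^ 2 ≤ (δ / m) ^ 2 * m := by gcongr
  have hquad_eq : (δ / m) ^ 2 * m = δ ^ 2 / m := by field_simp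
  have hcross_eq : δ / m * δ = δ ^ 2 / m := by ring
  have hmC : δ ^ 2 / C ≤ δ ^ 2 / m := by gcongr
  rw [sub_right_comm, norm_sub_sq_real, real_inner_smul_right, real_inner_comm, norm_smul, mul_pow,
    Real.norm_eq_abs, sq_abs]
  linarith

/-- Deterministic subgradient method with the safeguarded Polyak step size
(Corollary 3.3): the iterates
`x^{t+1} = x^t − ((f(x^t) − f(x*)) / max{‖g(x^t)‖², M})·g(x^t)` satisfy
`min_{0 ≤ t ≤ T−1} (f(x^t) − f(x*)) ≤ √(max{G², M})·‖x⁰ − x*‖/√T`. -/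
theorem det_subgradient_sps_safe (d T : ℕ) (hd : 1 ≤ d) (hT : 1 ≤ T)
    (f : EuclideanSpace ℝ (Fin d) → ℝ)
    (g : EuclideanSpace ℝ (Fin d) → EuclideanSpace ℝ (Fin d))
    (G M : ℝ)
    (hconv : ∀ x y, f x + ⟪g x, y - x⟫ ≤ f y)
    (hG : ∀ x, ‖g x‖ ≤ G)
    (xstar : EuclideanSpace ℝ (Fin d))
    (hmin : ∀ x, f xstar ≤ f x)
    (hM : 0 < M)
    (x : ℕ → EuclideanSpace ℝ (Fin d))
    (hstep : ∀ t : ℕ, t < T →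
      x (t + 1) = x t - ((f (x t) - f xstar) / max (‖g (x t)‖ ^ 2) M) • g (x t)) :
    (Finset.range T).inf' (Finset.nonempty_range_iff.mpr (by omega))
        (fun t => f (x t) - f xstar) ≤
      Real.sqrt (max (G ^ 2) M) * ‖x 0 - xstar‖ / Real.sqrt T := by
  have hne : (Finset.range T).Nonempty := Finset.nonempty_range_iff.mpr (by omega)
  set C := max (G ^ 2) M
  set m := (Finset.range T).inf' hne (fun t => f (x t) - f xstar)
  have hC : 0 < C := hM.trans_le (le_max_right _ _)
  have hm : 0 ≤ m := Finset.le_inf' _ _ fun t _ => sub_nonneg.mpr (hmin _)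
  have hdescent : ∀ n ≤ T, ‖x n - xstar‖ ^ 2 ≤ ‖x 0 - xstar‖ ^ 2 - n * (m ^ 2 / C) := by
    intro n
    induction n with
    | zero => simp
    | succ n ih =>
      intro hn
      have hle : m ≤ f (x n) - f xstar := Finset.inf'_le _ (Finset.mem_range.mpr hn)
      have hsubgrad : f (x n) - f xstar ≤ ⟪g (x n), x n - xstar⟫ := by
        have := hconv (x n) xstar
        rw [← neg_sub, inner_neg_right] at this
        linarith
      have hbound : max (‖g (x n)‖ ^ 2) M ≤ C :=
        max_le_max_right _ (pow_le_pow_left₀ (norm_nonneg _) (hG _) 2)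
      have hstep_le := norm_sq_polyak_step_sub_le hM hbound (hm.trans hle) hsubgrad
      rw [← hstep n hn] at hstep_le
      have : m ^ 2 / C ≤ (f (x n) - f xstar) ^ 2 / C := by gcongr
      push_cast
      linarith [ih (by omega)]
  have hT0 : (0 : ℝ) < T := by exact_mod_cast hT
  have hsum : T * (m ^ 2 / C) ≤ ‖x 0 - xstar‖ ^ 2 := by
    linarith [hdescent T le_rfl, sq_nonneg ‖x T - xstar‖]
  rw [le_div_iff₀ (Real.sqrt_pos.mpr hT0)]
  refine abs_le_of_sq_le_sq' ?_ (by positivity) |>.2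
  rw [mul_pow, mul_pow, Real.sq_sqrt hT0.le, Real.sq_sqrt hC.le]
  calc m ^ 2 * T = C * (T * (m ^ 2 / C)) := by field_simp
    _ ≤ C * ‖x 0 - xstar‖ ^ 2 := by gcongr
end

section
/- Equivalence of safeguarded SPS with adaptively clipped subgradient steps: for any x ∈ ℝ^d, any g ∈ ℝ^d with g ≠ 0, any real a, and any c > 0, one has x − (a / max{‖g‖², c²})·g = x − (a / (c·max{c, ‖g‖}))·clip_c(g). In particular, the SSM update with step size SPS_safe and safeguard M = c² coincides with the clipped SSM update using the adaptive step size γ̃ = (f_i(x) − ℓ_i)/(c·max{c, ‖g‖}). -/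
/-- Equivalence of the safeguarded SPS update with an adaptively clipped
subgradient step: for any `x`, any nonzero `g`, any real `a` and any `c > 0`,
`x − (a / max{‖g‖², c²})·g = x − (a / (c·max{c, ‖g‖}))·clip_c(g)`, where
`clip_c(g) = min{1, c/‖g‖}·g`.  In particular, SSM with step size `SPS_safe`
and safeguard `M = c²` coincides with clipped SSM with the adaptive step size
`γ̃ = (f_i(x) − ℓ_i)/(c·max{c, ‖g‖})`. -/
theorem sps_safe_eq_clipped_step (d : ℕ) (hd : 1 ≤ d)
    (x g : EuclideanSpace ℝ (Fin d)) (hg : g ≠ 0) (a c : ℝ) (hc : 0 < c) :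
    x - (a / max (‖g‖ ^ 2) (c ^ 2)) • g =
      x - (a / (c * max c ‖g‖)) • (min 1 (c / ‖g‖) • g) := by
  have hn : 0 < ‖g‖ := norm_pos_iff.mpr hg
  rw [smul_smul]
  congr 2
  rcases le_total ‖g‖ c with h | h
  · rw [max_eq_right (pow_le_pow_left₀ hn.le h 2), max_eq_left h,
      min_eq_left ((one_le_div hn).mpr h), mul_one, sq]
  · rw [max_eq_left (pow_le_pow_left₀ hc.le h 2), max_eq_right h,
      min_eq_right ((div_le_one hn).mpr h)]
    field_simp
end

section
/- One-step descent inequality for SSM with SPS_safe: let h : ℝ^d → ℝ, x, x* ∈ ℝ^d, and g ∈ ℝ^d satisfy the subgradient inequality ⟨g, x − x*⟩ ≥ h(x) − h(x*), and assume ‖g‖ ≤ G, ℓ ≤ h(x), and M > 0. Define γ = (h(x) − ℓ)/max{‖g‖², M} and x⁺ = x − γ·g. Then ‖x⁺ − x*‖² ≤ ‖x − x*‖² − (h(x) − h(x*))²/max{G², M} + (h(x*) − ℓ)²/M. -/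
open RealInnerProductSpace

/-- One-step descent inequality for SSM with the safeguarded Polyak step size
`SPS_safe`: if `⟨g, x − x*⟩ ≥ h(x) − h(x*)`, `‖g‖ ≤ G`, `ℓ ≤ h(x)`, `M > 0`,
and `x⁺ = x − γ·g` with `γ = (h(x) − ℓ)/max{‖g‖², M}`, then
`‖x⁺ − x*‖² ≤ ‖x − x*‖² − (h(x) − h(x*))²/max{G², M} + (h(x*) − ℓ)²/M`. -/
theorem sps_safe_one_step (d : ℕ) (hd : 1 ≤ d)
    (h : EuclideanSpace ℝ (Fin d) → ℝ)
    (x xstar g : EuclideanSpace ℝ (Fin d)) (G ℓ M : ℝ)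
    (hsub : h x - h xstar ≤ ⟪g, x - xstar⟫)
    (hG : ‖g‖ ≤ G) (hl : ℓ ≤ h x) (hM : 0 < M) :
    ‖(x - ((h x - ℓ) / max (‖g‖ ^ 2) M) • g) - xstar‖ ^ 2 ≤
      ‖x - xstar‖ ^ 2 - (h x - h xstar) ^ 2 / max (G ^ 2) M +
        (h xstar - ℓ) ^ 2 / M := by
  set D := max (‖g‖ ^ 2) M
  have hMD : M ≤ D := le_max_right _ _
  have hgD : ‖g‖ ^ 2 ≤ D := le_max_left _ _
  have hDpos : 0 < D := hM.trans_le hMD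
  have hDG : D ≤ max (G ^ 2) M :=
    max_le_max_right M (pow_le_pow_left₀ (norm_nonneg g) hG 2)
  have hgap : (h x - h xstar) ^ 2 / max (G ^ 2) M ≤ (h x - h xstar) ^ 2 / D :=
    div_le_div_of_nonneg_left (sq_nonneg _) hDpos hDG
  have hbias : (h xstar - ℓ) ^ 2 / D ≤ (h xstar - ℓ) ^ 2 / M :=
    div_le_div_of_nonneg_left (sq_nonneg _) hM hMD
  set γ := (h x - ℓ) / D with hγ
  have hγ_nonneg : 0 ≤ γ := div_nonneg (sub_nonneg.2 hl) hDpos.le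
  have hexpand : ‖(x - γ • g) - xstar‖ ^ 2 =
      ‖x - xstar‖ ^ 2 - 2 * (γ * ⟪g, x - xstar⟫) + γ ^ 2 * ‖g‖ ^ 2 := by
    rw [sub_right_comm, norm_sub_sq_real, inner_smul_right, real_inner_comm, norm_smul,
      mul_pow, Real.norm_eq_abs, sq_abs]
  have hinner : γ * (h x - h xstar) ≤ γ * ⟪g, x - xstar⟫ :=
    mul_le_mul_of_nonneg_left hsub hγ_nonneg
  have hquad : γ ^ 2 * ‖g‖ ^ 2 ≤ γ ^ 2 * D :=
    mul_le_mul_of_nonneg_left hgD (sq_nonneg γ)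
  have hsquare : -2 * (γ * (h x - h xstar)) + γ ^ 2 * D =
      (h xstar - ℓ) ^ 2 / D - (h x - h xstar) ^ 2 / D := by
    rw [hγ]
    field_simp
    ring
  linarith
end

section
/- One-step descent inequality for IMA with IMA-SPS_safe: let h : ℝ^d → ℝ, x_prev, x, x* ∈ ℝ^d, and g ∈ ℝ^d satisfy the subgradient inequality ⟨g, x − x*⟩ ≥ h(x) − h(x*), and assume ‖g‖ ≤ G, ℓ ≤ h(x*), λ ≥ 0, and M > 0. Set z = x + λ·(x − x_prev), q = h(x) + λ·⟨g, x − x_prev⟩, η = [q − ℓ]₊ / max{‖g‖², M}, and z⁺ = z − η·g. Then ‖z⁺ − x*‖² ≤ ‖z − x*‖² − ([q − h(x*)]₊)²/max{G², M} + (h(x*) − ℓ)²/M. -/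
open RealInnerProductSpace

/-- Moving from `w` along `-g` with step `p / D`, where `a ≤ ⟪g, w⟫` and `‖g‖² ≤ D`. -/
theorem norm_sub_div_smul_sq_le {E : Type*} [NormedAddCommGroup E] [InnerProductSpace ℝ E]
    {g w : E} {a p D : ℝ} (ha : a ≤ ⟪g, w⟫) (hp : 0 ≤ p) (hD : 0 < D) (hg : ‖g‖ ^ 2 ≤ D) :
    ‖w - (p / D) • g‖ ^ 2 ≤ ‖w‖ ^ 2 + p * (p - 2 * a) / D := by
  have hη : 0 ≤ p / D := div_nonneg hp hD.le
  rw [norm_sub_sq_real, inner_smul_right, real_inner_comm, norm_smul, mul_pow,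
    Real.norm_eq_abs, sq_abs]
  have h1 := mul_le_mul_of_nonneg_left ha hη
  have h2 := mul_le_mul_of_nonneg_left hg (sq_nonneg (p / D))
  have h3 : p * (p - 2 * a) / D = (p / D) ^ 2 * D - 2 * (p / D * a) := by
    field_simp
  linarith

theorem posPart_add_mul_sub_div_le {a b M D K : ℝ} (hb : 0 ≤ b) (hM : 0 < M) (hMD : M ≤ D)
    (hDK : D ≤ K) :
    max (a + b) 0 * (max (a + b) 0 - 2 * a) / D ≤ b ^ 2 / M - max a 0 ^ 2 / K := by
  have hD : 0 < D := hM.trans_le hMD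
  have h1 : b ^ 2 / D ≤ b ^ 2 / M := by gcongr
  have h2 : max a 0 ^ 2 / K ≤ max a 0 ^ 2 / D := by gcongr
  have h3 : max (a + b) 0 * (max (a + b) 0 - 2 * a) ≤ b ^ 2 - max a 0 ^ 2 := by
    rcases le_total (a + b) 0 with hab | hab
    · rw [max_eq_right hab, max_eq_right (by linarith : a ≤ 0)]
      nlinarith [sq_nonneg b]
    · rw [max_eq_left hab]
      rcases le_total a 0 with h0 | h0
      · rw [max_eq_right h0]
        nlinarith [sq_nonneg a]
      · rw [max_eq_left h0]
        linarith
  have h4 := div_le_div_of_nonneg_right h3 hD.le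
  rw [sub_div] at h4
  linarith

/-- One-step descent inequality for IMA with the safeguarded Polyak step size
`IMA-SPS_safe`: with `z = x + λ·(x − x_prev)`, `q = h(x) + λ·⟨g, x − x_prev⟩`,
`η = [q − ℓ]₊ / max{‖g‖², M}` and `z⁺ = z − η·g`, under the subgradient
inequality `⟨g, x − x*⟩ ≥ h(x) − h(x*)`, `‖g‖ ≤ G`, `ℓ ≤ h(x*)`, `λ ≥ 0`,
`M > 0`, one has
`‖z⁺ − x*‖² ≤ ‖z − x*‖² − ([q − h(x*)]₊)²/max{G², M} + (h(x*) − ℓ)²/M`. -/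
theorem ima_sps_safe_one_step (d : ℕ) (hd : 1 ≤ d)
    (h : EuclideanSpace ℝ (Fin d) → ℝ)
    (xprev x xstar g : EuclideanSpace ℝ (Fin d)) (G ℓ lam M : ℝ)
    (hsub : h x - h xstar ≤ ⟪g, x - xstar⟫)
    (hG : ‖g‖ ≤ G) (hl : ℓ ≤ h xstar) (hlam : 0 ≤ lam) (hM : 0 < M) :
    ‖((x + lam • (x - xprev)) -
        ((max (h x + lam * ⟪g, x - xprev⟫ - ℓ) 0 / max (‖g‖ ^ 2) M) • g)) -
          xstar‖ ^ 2 ≤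
      ‖(x + lam • (x - xprev)) - xstar‖ ^ 2 -
        (max (h x + lam * ⟪g, x - xprev⟫ - h xstar) 0) ^ 2 / max (G ^ 2) M +
          (h xstar - ℓ) ^ 2 / M := by
  have hinner : h x + lam * ⟪g, x - xprev⟫ - h xstar ≤
      ⟪g, (x + lam • (x - xprev)) - xstar⟫ := by
    rw [add_sub_right_comm, add_sub_right_comm x, inner_add_right, inner_smul_right]
    linarith
  have hstep := norm_sub_div_smul_sq_le (D := max (‖g‖ ^ 2) M) hinner
    (le_max_right (h x + lam * ⟪g, x - xprev⟫ - ℓ) 0) (lt_max_of_lt_right hM) (le_max_left _ _)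
  have hK : max (‖g‖ ^ 2) M ≤ max (G ^ 2) M := by gcongr
  have hscalar := posPart_add_mul_sub_div_le (a := h x + lam * ⟪g, x - xprev⟫ - h xstar)
    (sub_nonneg.mpr hl) hM (le_max_right (‖g‖ ^ 2) M) hK
  rw [sub_add_sub_cancel] at hscalar
  rw [sub_right_comm]
  linarith
end

section
/- For all reals q, ℓ, s with ℓ ≤ s, one has −2·[q − ℓ]₊·(q − s) + ([q − ℓ]₊)² ≤ (s − ℓ)² − ([q − s]₊)². -/
/-- Key scalar inequality in the one-step analysis of IMA with the safeguarded
Polyak step size: for all reals `q, ℓ, s` with `ℓ ≤ s`,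
`−2·[q − ℓ]₊·(q − s) + ([q − ℓ]₊)² ≤ (s − ℓ)² − ([q − s]₊)²`. -/
theorem neg_two_posPart_mul_add_sq_le (q ℓ s : ℝ) (hls : ℓ ≤ s) :
    -2 * max (q - ℓ) 0 * (q - s) + (max (q - ℓ) 0) ^ 2 ≤
      (s - ℓ) ^ 2 - (max (q - s) 0) ^ 2 := by
  rcases le_total q ℓ with hq | hq
  · rw [max_eq_right (by linarith : q - ℓ ≤ 0), max_eq_right (by linarith : q - s ≤ 0)]
    nlinarith [sq_nonneg (s - ℓ)]
  · rw [max_eq_left (by linarith : 0 ≤ q - ℓ)]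
    rcases le_total q s with hs | hs
    · rw [max_eq_right (by linarith : q - s ≤ 0)]
      nlinarith [sq_nonneg (q - s)]
    · rw [max_eq_left (by linarith : 0 ≤ q - s)]
      exact le_of_eq (by ring)
end

section
/- Let (Ω, F, μ) be a probability space, let X : Ω → ℝ and Y : Ω → ℝ be measurable with Y > 0 almost everywhere, and assume X, Y, and ([X]₊)²/Y are integrable. Then E[([X]₊)²/Y] ≥ ([E X]₊)² / E[Y]. -/
open MeasureTheory

/-- The tangent-line bound at slope `c` for the perspective function `(x, y) ↦ ([x]₊)²/y`. -/
lemma two_mul_sub_sq_mul_le_posPart_sq_div {c x y : ℝ} (hc : 0 ≤ c) (hy : 0 < y) :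
    2 * c * x - c ^ 2 * y ≤ (max x 0) ^ 2 / y := by
  rw [le_div_iff₀ hy]
  have hx : c * y * x ≤ c * y * max x 0 :=
    mul_le_mul_of_nonneg_left (le_max_left _ _) (mul_nonneg hc hy.le)
  linarith [sq_nonneg (max x 0 - c * y)]

/-- Conditional-Jensen-type inequality (Lemma B.3 of Gower et al.): on a
probability space, if `Y > 0` almost everywhere and `X`, `Y`, `([X]₊)²/Y` are
integrable, then `E[([X]₊)²/Y] ≥ ([E X]₊)² / E[Y]`. -/
theorem posPart_sq_div_integral_le {Ω : Type*} [MeasurableSpace Ω]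
    (μ : Measure Ω) [IsProbabilityMeasure μ] (X Y : Ω → ℝ)
    (hXm : Measurable X) (hYm : Measurable Y)
    (hYpos : ∀ᵐ ω ∂μ, 0 < Y ω)
    (hX : Integrable X μ) (hY : Integrable Y μ)
    (hXY : Integrable (fun ω => (max (X ω) 0) ^ 2 / Y ω) μ) :
    (max (∫ ω, X ω ∂μ) 0) ^ 2 / (∫ ω, Y ω ∂μ) ≤
      ∫ ω, (max (X ω) 0) ^ 2 / Y ω ∂μ := by
  set m := max (∫ ω, X ω ∂μ) 0
  set s := ∫ ω, Y ω ∂μ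
  have hm : m * ∫ ω, X ω ∂μ = m ^ 2 := by
    rcases max_cases (∫ ω, X ω ∂μ) 0 with ⟨h, -⟩ | ⟨h, -⟩ <;> simp only [m, h] <;> ring
  have hc : 0 ≤ m / s :=
    div_nonneg (le_max_right _ _) (integral_nonneg_of_ae (hYpos.mono fun _ h => h.le))
  calc m ^ 2 / s = 2 * (m / s) * ∫ ω, X ω ∂μ - (m / s) ^ 2 * s := by
        rcases eq_or_ne s 0 with hs | hs
        · simp [hs]
        · field_simp
          linarith
    _ = ∫ ω, (2 * (m / s) * X ω - (m / s) ^ 2 * Y ω) ∂μ := by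
        rw [integral_sub (hX.const_mul _) (hY.const_mul _), integral_const_mul,
          integral_const_mul]
    _ ≤ ∫ ω, (max (X ω) 0) ^ 2 / Y ω ∂μ :=
        integral_mono_ae ((hX.const_mul _).sub (hY.const_mul _)) hXY
          (hYpos.mono fun ω hω => two_mul_sub_sq_mul_le_posPart_sq_div hc hω)
end

section
/- Expected one-step inequality for SSM with SPS_safe: for every x ∈ ℝ^d, (1/n)·Σ_{i=1}^n ‖x − γ_i(x)·g_i(x) − x*‖² ≤ ‖x − x*‖² − (f(x) − f(x*))²/max{G², M} + σ⁴/M, where γ_i(x) = (f_i(x) − ℓ_i)/max{‖g_i(x)‖², M} and σ⁴ = (1/n)·Σ_{i=1}^n (f_i(x*) − ℓ_i)². -/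
open RealInnerProductSpace

/-- One safeguarded Polyak step along a vector `v`, where `a` and `b` are the excesses of the
function value over its lower bound at the current and at the comparison point. -/
lemma norm_sq_polyak_step_le {E : Type*} [NormedAddCommGroup E] [InnerProductSpace ℝ E]
    {G M a b : ℝ} {x y v : E} (hM : 0 < M) (hG : ‖v‖ ≤ G) (ha : 0 ≤ a)
    (hv : a + ⟪v, y - x⟫ ≤ b) :
    ‖x - (a / max (‖v‖ ^ 2) M) • v - y‖ ^ 2 ≤
      ‖x - y‖ ^ 2 - (a - b) ^ 2 / max (G ^ 2) M + b ^ 2 / M := by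
  set m := max (‖v‖ ^ 2) M with hm
  have hMm : M ≤ m := le_max_right _ _
  have hm0 : 0 < m := hM.trans_le hMm
  have hvm : ‖v‖ ^ 2 ≤ m := le_max_left _ _
  have hmG : m ≤ max (G ^ 2) M := by rw [hm]; gcongr
  have hinner : a - b ≤ ⟪x - y, v⟫ := by
    rw [← neg_sub x y, inner_neg_right, real_inner_comm] at hv
    linarith
  calc ‖x - (a / m) • v - y‖ ^ 2
      = ‖x - y‖ ^ 2 - 2 * (a / m) * ⟪x - y, v⟫ + (a / m) ^ 2 * ‖v‖ ^ 2 := by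
        rw [sub_right_comm, norm_sub_sq_real, inner_smul_right, norm_smul, mul_pow,
          Real.norm_eq_abs, sq_abs]
        ring
    _ ≤ ‖x - y‖ ^ 2 - 2 * (a / m) * (a - b) + (a / m) ^ 2 * m := by gcongr
    _ = ‖x - y‖ ^ 2 - (a - b) ^ 2 / m + b ^ 2 / m := by field_simp; ring
    _ ≤ ‖x - y‖ ^ 2 - (a - b) ^ 2 / max (G ^ 2) M + b ^ 2 / M := by gcongr

/-- The square of a uniform average is at most the average of the squares. -/
lemma sq_average_le_average_sq {n : ℕ} (u : Fin n → ℝ) :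
    ((n : ℝ)⁻¹ * ∑ i, u i) ^ 2 ≤ (n : ℝ)⁻¹ * ∑ i, u i ^ 2 := by
  rcases n.eq_zero_or_pos with rfl | hn
  · simp
  have hn' : (0 : ℝ) < n := by exact_mod_cast hn
  have h : (∑ i, u i) ^ 2 ≤ n * ∑ i, u i ^ 2 := by
    simpa using sq_sum_le_card_mul_sum_sq (s := Finset.univ) (f := u)
  calc ((n : ℝ)⁻¹ * ∑ i, u i) ^ 2 = (n : ℝ)⁻¹ ^ 2 * (∑ i, u i) ^ 2 := mul_pow _ _ _
    _ ≤ (n : ℝ)⁻¹ ^ 2 * (n * ∑ i, u i ^ 2) := by gcongr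
    _ = (n : ℝ)⁻¹ * ∑ i, u i ^ 2 := by field_simp

/-- Expected one-step inequality for SSM with the safeguarded Polyak step size
`SPS_safe`: for every `x`,
`(1/n)·Σ_i ‖x − γ_i(x)·g_i(x) − x*‖²
  ≤ ‖x − x*‖² − (f(x) − f(x*))²/max{G², M} + σ⁴/M`,
where `γ_i(x) = (f_i(x) − ℓ_i)/max{‖g_i(x)‖², M}`,
`f = (1/n)·Σ_i f_i` and `σ⁴ = (1/n)·Σ_i (f_i(x*) − ℓ_i)²`. -/
theorem sps_safe_expected_one_step (d n : ℕ) (hd : 1 ≤ d) (hn : 1 ≤ n)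
    (f : Fin n → EuclideanSpace ℝ (Fin d) → ℝ)
    (g : Fin n → EuclideanSpace ℝ (Fin d) → EuclideanSpace ℝ (Fin d))
    (G M : ℝ) (ℓ : Fin n → ℝ)
    (hconv : ∀ i x y, f i x + ⟪g i x, y - x⟫ ≤ f i y)
    (hG : ∀ i x, ‖g i x‖ ≤ G)
    (hl : ∀ i x, ℓ i ≤ f i x)
    (xstar : EuclideanSpace ℝ (Fin d)) (hM : 0 < M)
    (x : EuclideanSpace ℝ (Fin d)) :
    (n : ℝ)⁻¹ * ∑ i,
        ‖x - ((f i x - ℓ i) / max (‖g i x‖ ^ 2) M) • g i x - xstar‖ ^ 2 ≤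
      ‖x - xstar‖ ^ 2 -
        ((n : ℝ)⁻¹ * ∑ i, f i x - (n : ℝ)⁻¹ * ∑ i, f i xstar) ^ 2 /
          max (G ^ 2) M +
        ((n : ℝ)⁻¹ * ∑ i, (f i xstar - ℓ i) ^ 2) / M := by
  have hn' : (n : ℝ) ≠ 0 := by exact_mod_cast (Nat.one_le_iff_ne_zero.mp hn)
  have hstep (i : Fin n) :
      ‖x - ((f i x - ℓ i) / max (‖g i x‖ ^ 2) M) • g i x - xstar‖ ^ 2 ≤
        ‖x - xstar‖ ^ 2 - (f i x - f i xstar) ^ 2 / max (G ^ 2) M +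
          (f i xstar - ℓ i) ^ 2 / M := by
    have h := norm_sq_polyak_step_le (b := f i xstar - ℓ i) hM (hG i x)
      (sub_nonneg.mpr (hl i x)) (by linarith [hconv i x xstar])
    rwa [sub_sub_sub_cancel_right] at h
  have hjensen := sq_average_le_average_sq fun i => f i x - f i xstar
  rw [Finset.sum_sub_distrib, mul_sub] at hjensen
  calc _ ≤ (n : ℝ)⁻¹ * ∑ i, (‖x - xstar‖ ^ 2 - (f i x - f i xstar) ^ 2 / max (G ^ 2) M +
          (f i xstar - ℓ i) ^ 2 / M) := by
        gcongr with i
        exact hstep i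
    _ = ‖x - xstar‖ ^ 2 - ((n : ℝ)⁻¹ * ∑ i, (f i x - f i xstar) ^ 2) / max (G ^ 2) M +
          ((n : ℝ)⁻¹ * ∑ i, (f i xstar - ℓ i) ^ 2) / M := by
        rw [Finset.sum_add_distrib, Finset.sum_sub_distrib, ← Finset.sum_div, ← Finset.sum_div,
          Finset.sum_const, Finset.card_univ, Fintype.card_fin, nsmul_eq_mul, mul_add, mul_sub,
          inv_mul_cancel_left₀ hn', mul_div_assoc, mul_div_assoc]
    _ ≤ _ := by gcongr
end

section
/- Expected one-step inequality for IMA with IMA-SPS_safe: let λ ≥ 0, let x_prev, x ∈ ℝ^d, and set z = x + λ·(x − x_prev). Then (1/n)·Σ_{i=1}^n ‖z − η_i·g_i(x) − x*‖² ≤ ‖z − x*‖² − ([f(x) − f(x*) + λ·⟨ḡ(x), x − x_prev⟩]₊)²/max{G², M} + σ⁴/M, where η_i = [f_i(x) − ℓ_i + λ·⟨g_i(x), x − x_prev⟩]₊ / max{‖g_i(x)‖², M}, ḡ(x) = (1/n)·Σ_{i=1}^n g_i(x), and σ⁴ = (1/n)·Σ_{i=1}^n (f_i(x*) − ℓ_i)².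 -/
open RealInnerProductSpace

/-- Splitting off the positive part of a Polyak-type numerator: with `s ≥ 0` and `M ≤ D ≤ C`,
the decrease `(2 [a]₊ (a - s) - [a]₊²) / D` is at least `[a - s]₊² / C - s² / M`. -/
theorem sq_posPart_sub_div_le {a s D C M : ℝ} (hs : 0 ≤ s) (hM : 0 < M) (hMD : M ≤ D)
    (hDC : D ≤ C) :
    (max (a - s) 0) ^ 2 / C - s ^ 2 / M ≤ (2 * max a 0 * (a - s) - (max a 0) ^ 2) / D := by
  have hD : 0 < D := hM.trans_le hMD
  have hC : (max (a - s) 0) ^ 2 / C ≤ (max (a - s) 0) ^ 2 / D := by gcongr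
  have hS : s ^ 2 / D ≤ s ^ 2 / M := by gcongr
  have key : (max (a - s) 0) ^ 2 - s ^ 2 ≤ 2 * max a 0 * (a - s) - (max a 0) ^ 2 := by
    rcases le_total a 0 with ha | ha
    · rw [max_eq_right ha, max_eq_right (by linarith)]
      nlinarith
    · rw [max_eq_left ha]
      rcases le_total (a - s) 0 with has | has
      · rw [max_eq_right has]
        nlinarith [sq_nonneg (a - s)]
      · rw [max_eq_left has]
        nlinarith
  have := div_le_div_of_nonneg_right key hD.le
  rw [sub_div] at this
  linarith

/-- One-step inequality for a safeguarded Polyak step along a vector `v` whose inner product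
with the displacement `w` to the comparison point is at least `a - s`. -/
theorem norm_sub_safeguarded_step_sq_le {E : Type*} [NormedAddCommGroup E]
    [InnerProductSpace ℝ E] {v w : E} {a s G M : ℝ} (hs : 0 ≤ s) (hM : 0 < M) (hv : ‖v‖ ≤ G)
    (hvw : a - s ≤ ⟪v, w⟫) :
    ‖w - (max a 0 / max (‖v‖ ^ 2) M) • v‖ ^ 2 ≤
      ‖w‖ ^ 2 - (max (a - s) 0) ^ 2 / max (G ^ 2) M + s ^ 2 / M := by
  have hDC : max (‖v‖ ^ 2) M ≤ max (G ^ 2) M := by gcongr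
  have main := sq_posPart_sub_div_le (a := a) hs hM (le_max_right (‖v‖ ^ 2) M) hDC
  have hvD : ‖v‖ ^ 2 ≤ max (‖v‖ ^ 2) M := le_max_left _ _
  have hD : 0 < max (‖v‖ ^ 2) M := hM.trans_le (le_max_right _ _)
  have hp : 0 ≤ max a 0 := le_max_right _ _
  rw [norm_sub_sq_real, real_inner_smul_right, real_inner_comm, norm_smul, mul_pow,
    Real.norm_eq_abs, sq_abs]
  generalize max (‖v‖ ^ 2) M = D at *
  generalize max a 0 = p at *
  have hquad : (p / D) ^ 2 * ‖v‖ ^ 2 ≤ p ^ 2 / D := by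
    calc (p / D) ^ 2 * ‖v‖ ^ 2 ≤ (p / D) ^ 2 * D := by gcongr
      _ = p ^ 2 / D := by field_simp
  have hlin : p / D * (a - s) ≤ p / D * ⟪v, w⟫ := by gcongr
  have hsplit : (2 * p * (a - s) - p ^ 2) / D = 2 * (p / D * (a - s)) - p ^ 2 / D := by ring
  linarith

/-- Jensen's inequality for the squared positive part of a uniform average. -/
theorem sq_posPart_average_le {n : ℕ} (t : Fin n → ℝ) :
    (max ((n : ℝ)⁻¹ * ∑ i, t i) 0) ^ 2 ≤ (n : ℝ)⁻¹ * ∑ i, (max (t i) 0) ^ 2 := by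
  have hle : max ((n : ℝ)⁻¹ * ∑ i, t i) 0 ≤ (n : ℝ)⁻¹ * ∑ i, max (t i) 0 := by
    refine max_le ?_ (by positivity)
    gcongr
    exact le_max_left _ _
  have hcs := sq_sum_le_card_mul_sum_sq (s := Finset.univ) (f := fun i => max (t i) 0)
  rw [Finset.card_univ, Fintype.card_fin] at hcs
  calc (max ((n : ℝ)⁻¹ * ∑ i, t i) 0) ^ 2 ≤ ((n : ℝ)⁻¹ * ∑ i, max (t i) 0) ^ 2 := by gcongr
    _ = (n : ℝ)⁻¹ ^ 2 * (∑ i, max (t i) 0) ^ 2 := by ring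
    _ ≤ (n : ℝ)⁻¹ ^ 2 * (n * ∑ i, (max (t i) 0) ^ 2) := by gcongr
    _ = (n : ℝ)⁻¹ * ∑ i, (max (t i) 0) ^ 2 := by
      rcases eq_or_ne (n : ℝ) 0 with h | h
      · simp [h]
      · field_simp

/-- Expected one-step inequality for IMA with the safeguarded Polyak step size
`IMA-SPS_safe`: with `λ ≥ 0` and `z = x + λ·(x − x_prev)`,
`(1/n)·Σ_i ‖z − η_i·g_i(x) − x*‖²
  ≤ ‖z − x*‖² − ([f(x) − f(x*) + λ·⟨ḡ(x), x − x_prev⟩]₊)²/max{G², M} + σ⁴/M`,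
where `η_i = [f_i(x) − ℓ_i + λ·⟨g_i(x), x − x_prev⟩]₊ / max{‖g_i(x)‖², M}`,
`ḡ(x) = (1/n)·Σ_i g_i(x)`, `f = (1/n)·Σ_i f_i` and
`σ⁴ = (1/n)·Σ_i (f_i(x*) − ℓ_i)²`. -/
theorem ima_sps_safe_expected_one_step (d n : ℕ) (hd : 1 ≤ d) (hn : 1 ≤ n)
    (f : Fin n → EuclideanSpace ℝ (Fin d) → ℝ)
    (g : Fin n → EuclideanSpace ℝ (Fin d) → EuclideanSpace ℝ (Fin d))
    (G M lam : ℝ) (ℓ : Fin n → ℝ)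
    (hconv : ∀ i x y, f i x + ⟪g i x, y - x⟫ ≤ f i y)
    (hG : ∀ i x, ‖g i x‖ ≤ G)
    (hl : ∀ i x, ℓ i ≤ f i x)
    (xstar : EuclideanSpace ℝ (Fin d)) (hM : 0 < M) (hlam : 0 ≤ lam)
    (xprev x : EuclideanSpace ℝ (Fin d)) :
    (n : ℝ)⁻¹ * ∑ i,
        ‖(x + lam • (x - xprev)) -
            ((max (f i x - ℓ i + lam * ⟪g i x, x - xprev⟫) 0 /
                max (‖g i x‖ ^ 2) M) • g i x) - xstar‖ ^ 2 ≤
      ‖(x + lam • (x - xprev)) - xstar‖ ^ 2 -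
        (max ((n : ℝ)⁻¹ * ∑ i, f i x - (n : ℝ)⁻¹ * ∑ i, f i xstar +
            lam * ⟪(n : ℝ)⁻¹ • ∑ i, g i x, x - xprev⟫) 0) ^ 2 /
          max (G ^ 2) M +
        ((n : ℝ)⁻¹ * ∑ i, (f i xstar - ℓ i) ^ 2) / M := by
  have hn0 : (n : ℝ) ≠ 0 := by positivity
  set t : Fin n → ℝ := fun i => f i x - f i xstar + lam * ⟪g i x, x - xprev⟫ with ht
  have hmean : (n : ℝ)⁻¹ * ∑ i, f i x - (n : ℝ)⁻¹ * ∑ i, f i xstar +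
      lam * ⟪(n : ℝ)⁻¹ • ∑ i, g i x, x - xprev⟫ = (n : ℝ)⁻¹ * ∑ i, t i := by
    rw [real_inner_smul_left, sum_inner, ht, Finset.sum_add_distrib, Finset.sum_sub_distrib,
      ← Finset.mul_sum]
    ring
  have hstep : ∀ i, ‖(x + lam • (x - xprev)) -
      ((max (f i x - ℓ i + lam * ⟪g i x, x - xprev⟫) 0 /
        max (‖g i x‖ ^ 2) M) • g i x) - xstar‖ ^ 2 ≤
      ‖(x + lam • (x - xprev)) - xstar‖ ^ 2 - (max (t i) 0) ^ 2 / max (G ^ 2) M +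
        (f i xstar - ℓ i) ^ 2 / M := by
    intro i
    have hti : f i x - ℓ i + lam * ⟪g i x, x - xprev⟫ - (f i xstar - ℓ i) = t i := by
      simp only [ht]
      ring
    rw [sub_right_comm, ← hti]
    refine norm_sub_safeguarded_step_sq_le (sub_nonneg.2 (hl i xstar)) hM (hG i x) ?_
    have hc := hconv i x xstar
    rw [← neg_sub x xstar, inner_neg_right] at hc
    rw [add_sub_right_comm x, inner_add_right, real_inner_smul_right]
    linarith
  have hC : 0 < max (G ^ 2) M := hM.trans_le (le_max_right _ _)
  have hjensen := div_le_div_of_nonneg_right (sq_posPart_average_le t) hC.le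
  rw [hmean]
  calc _ ≤ (n : ℝ)⁻¹ * ∑ i, (‖(x + lam • (x - xprev)) - xstar‖ ^ 2 -
        (max (t i) 0) ^ 2 / max (G ^ 2) M + (f i xstar - ℓ i) ^ 2 / M) := by
        gcongr with i
        exact hstep i
    _ = ‖(x + lam • (x - xprev)) - xstar‖ ^ 2 -
        ((n : ℝ)⁻¹ * ∑ i, (max (t i) 0) ^ 2) / max (G ^ 2) M +
        ((n : ℝ)⁻¹ * ∑ i, (f i xstar - ℓ i) ^ 2) / M := by
      rw [Finset.sum_add_distrib, Finset.sum_sub_distrib, Finset.sum_const, Finset.card_univ,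
        Fintype.card_fin, nsmul_eq_mul, ← Finset.sum_div, ← Finset.sum_div, mul_add, mul_sub,
        inv_mul_cancel_left₀ hn0, mul_div_assoc, mul_div_assoc]
    _ ≤ _ := by linarith
end
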